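/- Fix J ∈ (−2√2, 3) and consider the Kepler problem in rotating coordinates, i.e. the Hamiltonian system on ℝ²×ℝ² with Hamiltonian H₀(x,y) = |y|²/2 − xᵗJ̃y − 1/|x| (J̃ = [[0,1],[−1,0]]). For (x,y) with G ≠ 0 and H₀ + G < 0, define G = x₁y₂ − x₂y₁, L = (−2(H₀(x,y)+G))^{−1/2} and e = √(1 − G²/L²). Let 𝒱 = {(x,y) ∈ ℝ⁴ : x ≠ 0, G ≠ 0, H₀+G < 0, |G| < L, G²/(1+e) < 1 < G²/(1−e)} and 𝒱_J = 𝒱 ∩ {−2H₀ = J}. Then the set of points of 𝒱_J whose orbit under the flow of H₀ passes through the position x = (1,0) at some time is dense in 𝒱_J. -/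

import Mathlib

noncomputable section

/-- `(x1, x2, y1, y2)` is a solution of the Kepler problem in rotating coordinates
(Hamiltonian `H₀(x,y) = |y|²/2 − xᵗJ̃y − 1/|x|`) on the set of times `s`. -/
def IsKeplerSol (s : Set ℝ) (x1 x2 y1 y2 : ℝ → ℝ) : Prop :=
  ∀ t ∈ s,
    HasDerivAt x1 (y1 t + x2 t) t ∧
    HasDerivAt x2 (y2 t - x1 t) t ∧
    HasDerivAt y1 (y2 t - x1 t / (Real.sqrt (x1 t ^ 2 + x2 t ^ 2)) ^ 3) t ∧
    HasDerivAt y2 (- y1 t - x2 t / (Real.sqrt (x1 t ^ 2 + x2 t ^ 2)) ^ 3) t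

/-- The Hamiltonian `H₀(x,y) = |y|²/2 − xᵗJ̃y − 1/|x|` of the Kepler problem in
rotating coordinates, on points `p = (x₁, x₂, y₁, y₂)`. -/
def KepH0 (p : ℝ × ℝ × ℝ × ℝ) : ℝ :=
  (p.2.2.1 ^ 2 + p.2.2.2 ^ 2) / 2 - (p.1 * p.2.2.2 - p.2.1 * p.2.2.1)
    - 1 / Real.sqrt (p.1 ^ 2 + p.2.1 ^ 2)

/-- The angular momentum `G = x₁y₂ − x₂y₁`. -/
def KepG (p : ℝ × ℝ × ℝ × ℝ) : ℝ := p.1 * p.2.2.2 - p.2.1 * p.2.2.1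

/-- The Delaunay action `L = (−2(H₀+G))^{−1/2}` (square root of the semimajor axis). -/
def KepL (p : ℝ × ℝ × ℝ × ℝ) : ℝ := (-2 * (KepH0 p + KepG p)) ^ (-(1 : ℝ) / 2)

/-- The eccentricity `e = √(1 − G²/L²)`. -/
def KepE (p : ℝ × ℝ × ℝ × ℝ) : ℝ := Real.sqrt (1 - (KepG p) ^ 2 / (KepL p) ^ 2)

/-- The open region `𝒱` of ellipses crossing the unit circle. -/
def KepV : Set (ℝ × ℝ × ℝ × ℝ) :=
  {p | (p.1, p.2.1) ≠ (0, 0) ∧ KepG p ≠ 0 ∧ KepH0 p + KepG p < 0 ∧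
    |KepG p| < KepL p ∧
    (KepG p) ^ 2 / (1 + KepE p) < 1 ∧ 1 < (KepG p) ^ 2 / (1 - KepE p)}

/-- The region `𝒱_J = 𝒱 ∩ {−2H₀ = J}`. -/
def KepVJ (J : ℝ) : Set (ℝ × ℝ × ℝ × ℝ) := KepV ∩ {p | -2 * KepH0 p = J}

/-- The orbit of `p` under the flow of `H₀` passes through the position `x = (1,0)`
at some time. -/
def ReachesCollision (p : ℝ × ℝ × ℝ × ℝ) : Prop :=
  ∃ (t : ℝ) (x1 x2 y1 y2 : ℝ → ℝ),
    IsKeplerSol (Set.uIcc 0 t) x1 x2 y1 y2 ∧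
    (x1 0, x2 0, y1 0, y2 0) = p ∧ x1 t = 1 ∧ x2 t = 0

/-- Phase point with orbital elements `w = 1/L`, eccentricity `e`, `k = G/L`, eccentric anomaly `u`
and argument of perihelion `g`. -/
def KepP (w e k u g : ℝ) : ℝ × ℝ × ℝ × ℝ :=
  ((Real.cos g * (Real.cos u - e) - Real.sin g * (k * Real.sin u)) / w ^ 2,
   (Real.sin g * (Real.cos u - e) + Real.cos g * (k * Real.sin u)) / w ^ 2,
   w * (-(Real.cos g * Real.sin u) - Real.sin g * (k * Real.cos u)) / (1 - e * Real.cos u),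
   w * (-(Real.sin g * Real.sin u) + Real.cos g * (k * Real.cos u)) / (1 - e * Real.cos u))

lemma kep_den_pos {e : ℝ} (he0 : 0 ≤ e) (he1 : e < 1) (u : ℝ) : 0 < 1 - e * Real.cos u := by
  nlinarith [Real.cos_le_one u, Real.neg_one_le_cos u]

lemma kepP_r {w e k : ℝ} (hw : 0 < w) (he0 : 0 ≤ e) (he1 : e < 1) (hek : e ^ 2 + k ^ 2 = 1)
    (u g : ℝ) :
    Real.sqrt ((KepP w e k u g).1 ^ 2 + (KepP w e k u g).2.1 ^ 2) = (1 - e * Real.cos u) / w ^ 2 := by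
  have hd := kep_den_pos he0 he1 u
  rw [Real.sqrt_eq_iff_mul_self_eq (by positivity) (by positivity)]
  simp only [KepP]
  field_simp
  have hg := Real.sin_sq_add_cos_sq g
  have hu := Real.sin_sq_add_cos_sq u
  have hk : k ^ 2 = 1 - e ^ 2 := by linarith
  have hsg : Real.sin g ^ 2 = 1 - Real.cos g ^ 2 := by linarith
  have hsu : Real.sin u ^ 2 = 1 - Real.cos u ^ 2 := by linarith
  have : (Real.cos g * (Real.cos u - e) - k * Real.sin g * Real.sin u) ^ 2 +
      (Real.sin g * (Real.cos u - e) + k * Real.cos g * Real.sin u) ^ 2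
      = (Real.sin g ^ 2 + Real.cos g ^ 2) * ((Real.cos u - e) ^ 2 + k ^ 2 * Real.sin u ^ 2) := by
    ring
  have h2 : (Real.sin g ^ 2 + Real.cos g ^ 2) * ((Real.cos u - e) ^ 2 + k ^ 2 * Real.sin u ^ 2)
      = (1 - e * Real.cos u) ^ 2 := by
    rw [hg, hk, hsu]; ring
  linarith

lemma kepP_G {w e k : ℝ} (hw : 0 < w) (he0 : 0 ≤ e) (he1 : e < 1)
    (u g : ℝ) : KepG (KepP w e k u g) = k / w := by
  have hd := kep_den_pos he0 he1 u
  have hg := Real.sin_sq_add_cos_sq g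
  have hu := Real.sin_sq_add_cos_sq u
  simp only [KepG, KepP]
  field_simp
  have : (Real.cos g * (Real.cos u - e) - k * Real.sin g * Real.sin u) *
        (-(Real.sin g * Real.sin u) + k * Real.cos g * Real.cos u) -
      (Real.sin g * (Real.cos u - e) + k * Real.cos g * Real.sin u) *
        (-(Real.cos g * Real.sin u) - k * Real.sin g * Real.cos u) =
      k * ((Real.sin g ^ 2 + Real.cos g ^ 2) *
        ((Real.sin u ^ 2 + Real.cos u ^ 2) - e * Real.cos u)) := by ring
  rw [hg, hu] at this
  rw [div_eq_iff (by linarith [mul_comm e (Real.cos u)])]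
  linarith

lemma kepP_E {w e k : ℝ} (hw : 0 < w) (he0 : 0 ≤ e) (he1 : e < 1) (hek : e ^ 2 + k ^ 2 = 1)
    (u g : ℝ) : KepH0 (KepP w e k u g) + KepG (KepP w e k u g) = - w ^ 2 / 2 := by
  have hd := kep_den_pos he0 he1 u
  have hg := Real.sin_sq_add_cos_sq g
  have hu := Real.sin_sq_add_cos_sq u
  have hk : k ^ 2 = 1 - e ^ 2 := by linarith
  have hsu : Real.sin u ^ 2 = 1 - Real.cos u ^ 2 := by linarith
  have h1 : (KepP w e k u g).2.2.1 ^ 2 + (KepP w e k u g).2.2.2 ^ 2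
      = w ^ 2 * (1 + e * Real.cos u) / (1 - e * Real.cos u) := by
    simp only [KepP]
    rw [div_pow, div_pow, ← add_div, div_eq_div_iff (by positivity) (by positivity)]
    have : (w * (-(Real.cos g * Real.sin u) - Real.sin g * (k * Real.cos u))) ^ 2 +
      (w * (-(Real.sin g * Real.sin u) + Real.cos g * (k * Real.cos u))) ^ 2 =
      w ^ 2 * ((Real.sin g ^ 2 + Real.cos g ^ 2) * (Real.sin u ^ 2 + k ^ 2 * Real.cos u ^ 2)) := by
      ring
    rw [this, hg, hk, hsu]; ring
  rw [KepH0, kepP_r hw he0 he1 hek, h1, KepG]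
  field_simp
  ring

lemma kep_L_eq {p : ℝ × ℝ × ℝ × ℝ} {w : ℝ} (hw : 0 < w) (h : KepH0 p + KepG p = - w ^ 2 / 2) :
    KepL p = w⁻¹ := by
  rw [KepL, h, show -2 * (-w ^ 2 / 2) = w ^ (2 : ℝ) by rw [Real.rpow_two]; ring,
    ← Real.rpow_mul hw.le, ← Real.rpow_neg_one]
  norm_num

/-- Conditions on orbital elements. -/
def KepCond (J w e k : ℝ) : Prop :=
  0 < w ∧ 0 < e ∧ e < 1 ∧ e ^ 2 + k ^ 2 = 1 ∧ k ≠ 0 ∧ 1 - e < w ^ 2 ∧ w ^ 2 < 1 + e ∧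
    w ^ 2 + 2 * (k / w) = J

lemma kepP_mem {J w e k : ℝ} (h : KepCond J w e k) (u g : ℝ) : KepP w e k u g ∈ KepVJ J := by
  obtain ⟨hw, he0, he1, hek, hk, h1, h2, hJ⟩ := h
  have hG := kepP_G hw he0.le he1 (k := k) u g
  have hE := kepP_E hw he0.le he1 hek u g
  have hL := kep_L_eq hw hE
  have hr := kepP_r hw he0.le he1 hek u g
  have hd := kep_den_pos he0.le he1 u
  have hee : KepE (KepP w e k u g) = e := by
    rw [KepE, hG, hL, Real.sqrt_eq_iff_mul_self_eq _ he0.le]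
    · field_simp; linarith
    · field_simp; nlinarith
  have hk2 : k ^ 2 = (1 - e) * (1 + e) := by linarith
  refine ⟨⟨?_, ?_, ?_, ?_, ?_, ?_⟩, ?_⟩
  · intro h0
    rw [Prod.mk.injEq] at h0
    rw [h0.1, h0.2] at hr
    have : 0 < (1 - e * Real.cos u) / w ^ 2 := by positivity
    simp at hr
    rw [← hr] at this
    exact lt_irrefl _ this
  · rw [hG]; positivity
  · rw [hE]; have : 0 < w ^ 2 := by positivity
    linarith
  · rw [hG, hL, abs_div, abs_of_pos hw, div_eq_mul_inv]
    have : |k| < 1 := by rw [← sq_lt_one_iff_abs_lt_one]; nlinarith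
    have := inv_pos.2 hw
    nlinarith
  · rw [hG, hee, div_pow, hk2, div_div, div_lt_one (by positivity)]
    nlinarith
  · have : 0 < 1 - e := by linarith
    rw [hG, hee, div_pow, hk2, div_div, one_lt_div (by positivity)]
    nlinarith
  · change -2 * KepH0 _ = J
    rw [hG] at hE
    linarith

lemma kep_angle {a b : ℝ} (h : a ^ 2 + b ^ 2 = 1) : ∃ t, Real.cos t = a ∧ Real.sin t = b := by
  have hn : ‖(⟨a, b⟩ : ℂ)‖ = 1 := by
    rw [Complex.norm_def, Complex.normSq_mk, Real.sqrt_eq_one]; linarith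
  have h0 : (⟨a, b⟩ : ℂ) ≠ 0 := by intro h0; rw [h0] at hn; simp at hn
  refine ⟨Complex.arg ⟨a, b⟩, ?_, ?_⟩
  · rw [Complex.cos_arg h0, hn]; simp
  · rw [Complex.sin_arg, hn]; simp

lemma kep_rot {X Y a b : ℝ} (h0 : 0 < X ^ 2 + Y ^ 2) (h : X ^ 2 + Y ^ 2 = a ^ 2 + b ^ 2) :
    ∃ g, Real.cos g * X - Real.sin g * Y = a ∧ Real.sin g * X + Real.cos g * Y = b := by
  obtain ⟨g, hc, hs⟩ := kep_angle (a := (X * a + Y * b) / (X ^ 2 + Y ^ 2))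
    (b := (X * b - Y * a) / (X ^ 2 + Y ^ 2)) (by
      rw [div_pow, div_pow, ← add_div, div_eq_one_iff_eq (by positivity)]
      have : (X * a + Y * b) ^ 2 + (X * b - Y * a) ^ 2 = (X ^ 2 + Y ^ 2) * (a ^ 2 + b ^ 2) := by ring
      rw [this, ← h]; ring)
  refine ⟨g, ?_, ?_⟩
  · rw [hc, hs]; field_simp; ring
  · rw [hc, hs]; field_simp; ring

lemma kepP_surj {J : ℝ} {p : ℝ × ℝ × ℝ × ℝ} (hp : p ∈ KepVJ J) :
    ∃ w e k u g, KepCond J w e k ∧ p = KepP w e k u g := by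
  obtain ⟨⟨hx, hG, hE, hGL, h1, h2⟩, hJ⟩ := hp
  change -2 * KepH0 p = J at hJ
  obtain ⟨w, hw, hwE⟩ : ∃ w : ℝ, 0 < w ∧ KepH0 p + KepG p = - w ^ 2 / 2 := by
    refine ⟨Real.sqrt (-2 * (KepH0 p + KepG p)), Real.sqrt_pos.2 (by linarith), ?_⟩
    rw [Real.sq_sqrt (by linarith)]; ring
  have hL := kep_L_eq hw hwE
  set G := KepG p with hGdef
  have hlt : (G * w) ^ 2 < 1 := by
    rw [sq_lt_one_iff_abs_lt_one, abs_mul, abs_of_pos hw]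
    rw [hL] at hGL
    calc |G| * w < w⁻¹ * w := by gcongr
      _ = 1 := by field_simp
  obtain ⟨e, hee⟩ : ∃ e, e = KepE p := ⟨_, rfl⟩
  have he : e = Real.sqrt (1 - (G * w) ^ 2) := by
    rw [hee, KepE, hL, ← hGdef]; congr 1; field_simp
  have he0 : 0 < e := by rw [he]; exact Real.sqrt_pos.2 (by linarith)
  have he2 : e ^ 2 + (G * w) ^ 2 = 1 := by rw [he, Real.sq_sqrt (by linarith)]; ring
  have hk : G * w ≠ 0 := mul_ne_zero hG hw.ne'
  have hkp : 0 < (G * w) ^ 2 := by positivity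
  have he1 : e < 1 := by nlinarith
  rw [← hee] at h1 h2
  have h1e : 0 < 1 - e := by linarith
  have hG2 : G ^ 2 * w ^ 2 = (1 - e) * (1 + e) := by linarith [mul_pow G w 2]
  have hw2 : 0 < w ^ 2 := by positivity
  rw [div_lt_one (by positivity)] at h1
  rw [one_lt_div h1e] at h2
  have hcond : KepCond J w e (G * w) := by
    refine ⟨hw, he0, he1, he2, hk, ?_, ?_, ?_⟩
    · have : (1 - e) * (1 + e) < w ^ 2 * (1 + e) := by rw [← hG2]; nlinarith
      exact lt_of_mul_lt_mul_right this (by linarith)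
    · have : w ^ 2 * (1 - e) < (1 + e) * (1 - e) := by
        rw [mul_comm (1 + e), ← hG2]; nlinarith
      exact lt_of_mul_lt_mul_right this (by linarith)
    · rw [mul_div_assoc, div_self hw.ne']; linarith
  obtain ⟨x1, x2, y1, y2⟩ := p
  have hxx : 0 < x1 ^ 2 + x2 ^ 2 := by
    rcases eq_or_ne x1 0 with h | h
    · have : x2 ≠ 0 := by intro h'; exact hx (by simp [h, h'])
      positivity
    · positivity
  set r := Real.sqrt (x1 ^ 2 + x2 ^ 2) with hr
  have hr0 : 0 < r := Real.sqrt_pos.2 hxx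
  have hr2 : r ^ 2 = x1 ^ 2 + x2 ^ 2 := Real.sq_sqrt hxx.le
  have hGv : G = x1 * y2 - x2 * y1 := rfl
  have hen : (y1 ^ 2 + y2 ^ 2) / 2 - 1 / r = - w ^ 2 / 2 := by
    rw [← hwE, hGv]; simp only [KepH0, ← hr]; ring
  have hen2 : r ^ 2 * (y1 ^ 2 + y2 ^ 2) = 2 * r - r ^ 2 * w ^ 2 := by
    field_simp at hen
    linear_combination r * hen
  have hlag : (x1 * y1 + x2 * y2) ^ 2 + G ^ 2 = r ^ 2 * (y1 ^ 2 + y2 ^ 2) := by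
    rw [hr2, hGv]; ring
  obtain ⟨u, hc, hs⟩ := kep_angle (a := (1 - r * w ^ 2) / e) (b := w * (x1 * y1 + x2 * y2) / e) (by
    rw [div_pow, div_pow, ← add_div, div_eq_one_iff_eq (by positivity)]
    linear_combination w ^ 2 * hlag + w ^ 2 * hen2 - he2)
  have hc' : e * Real.cos u = 1 - r * w ^ 2 := by rw [hc]; field_simp
  have hs' : e * Real.sin u = w * (x1 * y1 + x2 * y2) := by rw [hs]; field_simp
  have hcs := Real.sin_sq_add_cos_sq u
  have hXY : ((Real.cos u - e) / w ^ 2) ^ 2 + (G * w * Real.sin u / w ^ 2) ^ 2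
      = x1 ^ 2 + x2 ^ 2 := by
    rw [← hr2, div_pow, div_pow, ← add_div, div_eq_iff (by positivity)]
    have hrw : r * w ^ 2 = 1 - e * Real.cos u := by linarith
    have : r ^ 2 * (w ^ 2) ^ 2 = (r * w ^ 2) ^ 2 := by ring
    rw [this, hrw]
    linear_combination Real.sin u ^ 2 * he2 + (1 - e ^ 2) * hcs
  obtain ⟨g, hg1, hg2⟩ := kep_rot (by rw [hXY]; exact hxx) hXY
  refine ⟨w, e, G * w, u, g, hcond, ?_⟩
  have hd := kep_den_pos he0.le he1 u
  have hrr : r = (1 - e * Real.cos u) / w ^ 2 := by rw [hc']; field_simp; ring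
  have hD : x1 * y1 + x2 * y2 = e * Real.sin u / w := by rw [hs']; field_simp
  have hy1 : r ^ 2 * y1 = (e * Real.sin u / w) * x1 - G * x2 := by
    rw [← hD, hr2, hGv]; ring
  have hy2 : r ^ 2 * y2 = (e * Real.sin u / w) * x2 + G * x1 := by
    rw [← hD, hr2, hGv]; ring
  simp only [KepP, Prod.mk.injEq]
  refine ⟨?_, ?_, ?_, ?_⟩
  · rw [← hg1]; ring
  · rw [← hg2]; ring
  · have : r ^ 2 ≠ 0 := by positivity
    apply mul_left_cancel₀ this
    rw [hy1, ← hg1, ← hg2, hrr]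
    field_simp
    linear_combination (-Real.sin u * Real.cos g) * he2 - w * G * Real.sin g * e * hcs
  · have : r ^ 2 ≠ 0 := by positivity
    apply mul_left_cancel₀ this
    rw [hy2, ← hg1, ← hg2, hrr]
    field_simp
    linear_combination (-Real.sin u * Real.sin g) * he2 + w * G * Real.cos g * e * hcs

lemma kep_inverse {e : ℝ} (he0 : 0 ≤ e) (he1 : e < 1) :
    ∃ U : ℝ → ℝ, Continuous U ∧ (∀ M, U M - e * Real.sin (U M) = M) ∧
      (∀ u, U (u - e * Real.sin u) = u) ∧
      ∀ M, HasDerivAt U (1 - e * Real.cos (U M))⁻¹ M := by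
  have hder : ∀ u, HasDerivAt (fun u => u - e * Real.sin u) (1 - e * Real.cos u) u := fun u =>
    (hasDerivAt_id u).sub ((Real.hasDerivAt_sin u).const_mul e)
  have hmono : StrictMono (fun u => u - e * Real.sin u) := by
    apply strictMono_of_deriv_pos
    intro u
    rw [(hder u).deriv]
    exact kep_den_pos he0 he1 u
  have hcont : Continuous (fun u => u - e * Real.sin u) := by fun_prop
  have hsurj : Function.Surjective (fun u => u - e * Real.sin u) := by
    intro M
    have h1 : ∀ v, e * Real.sin v ≤ 1 := fun v => by
      nlinarith [Real.sin_le_one v]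
    have h2 : ∀ v, -1 ≤ e * Real.sin v := fun v => by
      nlinarith [Real.neg_one_le_sin v]
    have := intermediate_value_Icc (show M - 1 ≤ M + 1 by linarith) hcont.continuousOn
    obtain ⟨u, -, hu⟩ := this (show M ∈ Set.Icc _ _ from
      ⟨by simpa using by linarith [h2 (M - 1)], by simpa using by linarith [h1 (M + 1)]⟩)
    exact ⟨u, hu⟩
  let f := hmono.orderIsoOfSurjective _ hsurj
  have hf1 : ∀ M, f.symm M - e * Real.sin (f.symm M) = M := fun M => f.apply_symm_apply M
  refine ⟨f.symm, f.symm.continuous, hf1, fun u => f.symm_apply_apply u, fun M => ?_⟩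
  exact HasDerivAt.of_local_left_inverse f.symm.continuous.continuousAt (hder _)
    (kep_den_pos he0 he1 _).ne' (Filter.Eventually.of_forall hf1)

lemma kepP_sol {w e k : ℝ} (hw : 0 < w) (he0 : 0 ≤ e) (he1 : e < 1) (hek : e ^ 2 + k ^ 2 = 1)
    {u g : ℝ → ℝ} (hu : ∀ t, HasDerivAt u (w ^ 3 * (1 - e * Real.cos (u t))⁻¹) t)
    (hg : ∀ t, HasDerivAt g (-1) t) (s : Set ℝ) :
    IsKeplerSol s (fun t => (KepP w e k (u t) (g t)).1) (fun t => (KepP w e k (u t) (g t)).2.1)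
      (fun t => (KepP w e k (u t) (g t)).2.2.1) (fun t => (KepP w e k (u t) (g t)).2.2.2) := by
  intro t _
  have hd := kep_den_pos he0 he1 (u t)
  have hr := kepP_r hw he0 he1 hek (u t) (g t)
  have hcu := (hu t).cos
  have hsu := (hu t).sin
  have hcg := (hg t).cos
  have hsg := (hg t).sin
  have hden := ((hcu.const_mul e).const_sub 1)
  have hcs := Real.sin_sq_add_cos_sq (u t)
  have hd' : 1 - Real.cos (u t) * e ≠ 0 := by rw [mul_comm]; exact hd.ne'
  simp only [hr]
  refine ⟨?_, ?_, ?_, ?_⟩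
  · refine (((hcg.mul (hcu.sub_const e)).sub (hsg.mul (hsu.const_mul k))).div_const (w ^ 2)).congr_deriv ?_
    simp only [KepP, Pi.mul_apply, Pi.sub_apply, Pi.add_apply, Pi.neg_apply]
    field_simp
    ring
  · refine (((hsg.mul (hcu.sub_const e)).add (hcg.mul (hsu.const_mul k))).div_const (w ^ 2)).congr_deriv ?_
    simp only [KepP, Pi.mul_apply, Pi.sub_apply, Pi.add_apply, Pi.neg_apply]
    field_simp
    ring
  · refine (((((hcg.mul hsu).neg.sub (hsg.mul (hcu.const_mul k))).const_mul w).div hden hd.ne')).congr_deriv ?_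
    simp only [KepP, Pi.mul_apply, Pi.sub_apply, Pi.add_apply, Pi.neg_apply]
    field_simp
    linear_combination w ^ 3 * Real.cos (g t) * e * hcs
  · refine (((((hsg.mul hsu).neg.add (hcg.mul (hcu.const_mul k))).const_mul w).div hden hd.ne')).congr_deriv ?_
    simp only [KepP, Pi.mul_apply, Pi.sub_apply, Pi.add_apply, Pi.neg_apply]
    field_simp
    linear_combination w ^ 3 * Real.sin (g t) * e * hcs

lemma kep_collision {J w e k : ℝ} (h : KepCond J w e k) :
    ∃ u g, (KepP w e k u g).1 = 1 ∧ (KepP w e k u g).2.1 = 0 := by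
  obtain ⟨hw, he0, he1, hek, hk, h1, h2, hJ⟩ := h
  have hb : ((1 - w ^ 2) / e) ^ 2 ≤ 1 := by
    rw [div_pow, div_le_one (by positivity)]
    nlinarith
  obtain ⟨u, hc, hs⟩ := kep_angle (a := (1 - w ^ 2) / e)
    (b := Real.sqrt (1 - ((1 - w ^ 2) / e) ^ 2)) (by rw [Real.sq_sqrt (by linarith)]; ring)
  have hc' : e * Real.cos u = 1 - w ^ 2 := by rw [hc]; field_simp
  have hcs := Real.sin_sq_add_cos_sq u
  have hXY : ((Real.cos u - e) / w ^ 2) ^ 2 + (k * Real.sin u / w ^ 2) ^ 2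
      = 1 ^ 2 + 0 ^ 2 := by
    rw [div_pow, div_pow, ← add_div, div_eq_iff (by positivity)]
    have hrw : w ^ 2 = 1 - e * Real.cos u := by linarith
    rw [hrw]
    linear_combination Real.sin u ^ 2 * hek + (1 - e ^ 2) * hcs
  obtain ⟨g, hg1, hg2⟩ := kep_rot (by rw [hXY]; norm_num) hXY
  refine ⟨u, g, ?_, ?_⟩
  · rw [← hg1]; simp only [KepP]; ring
  · rw [← hg2]; simp only [KepP]; ring

lemma kepP_cont_u {w e k : ℝ} (he0 : 0 ≤ e) (he1 : e < 1) (g : ℝ) :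
    Continuous (fun u => KepP w e k u g) := by
  have hd : ∀ u, 1 - e * Real.cos u ≠ 0 := fun u => (kep_den_pos he0 he1 u).ne'
  unfold KepP
  fun_prop (disch := assumption)

lemma kep_irr {J w e k : ℝ} (h : KepCond J w e k) (hirr : Irrational (w ^ 3)) (u g : ℝ) :
    KepP w e k u g ∈ closure {p ∈ KepVJ J | ReachesCollision p} := by
  obtain ⟨uc, gc, hx1, hx2⟩ := kep_collision h
  have hmem := kepP_mem h
  obtain ⟨hw, he0, he1, hek, hk, -⟩ := h
  obtain ⟨U, hUc, hU1, hU2, hU3⟩ := kep_inverse he0.le he1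
  have hper : ∀ M (m : ℤ), U (M + m * (2 * Real.pi)) = U M + m * (2 * Real.pi) := by
    intro M m
    rw [← hU2 (U M + m * (2 * Real.pi)), Real.sin_add_int_mul_two_pi]
    congr 1
    linarith [hU1 M]
  set Mc := uc - e * Real.sin uc with hMc
  have hdense : Dense (AddSubgroup.closure {2 * Real.pi * w ^ 3, 2 * Real.pi} : Set ℝ) := by
    rw [dense_addSubgroupClosure_pair_iff]
    rwa [mul_div_cancel_left₀ _ (by positivity)]
  have key : ∀ z ∈ (AddSubgroup.closure {2 * Real.pi * w ^ 3, 2 * Real.pi} : Set ℝ),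
      KepP w e k (U (Mc + w ^ 3 * (gc - g) + z)) g ∈ {p ∈ KepVJ J | ReachesCollision p} := by
    intro z hz
    refine ⟨hmem _ _, ?_⟩
    obtain ⟨a, m, rfl⟩ := AddSubgroup.mem_closure_pair.1 hz
    set t := gc - g + a * (2 * Real.pi) with ht
    have hPeq : KepP w e k (U (Mc + w ^ 3 * (gc - g) +
        (a • (2 * Real.pi * w ^ 3) + m • (2 * Real.pi)))) g
        = KepP w e k (U (Mc + w ^ 3 * (t + 0))) (gc - t - 0) := by
      have e1 : Mc + w ^ 3 * (gc - g) + (a • (2 * Real.pi * w ^ 3) + m • (2 * Real.pi))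
          = (Mc + w ^ 3 * (t + 0)) + m * (2 * Real.pi) := by
        simp only [zsmul_eq_mul, ht]; ring
      have e2 : g = (gc - t - 0) + a * (2 * Real.pi) := by rw [ht]; ring
      rw [e1, hper]
      conv_lhs => rw [e2]
      simp only [KepP, Real.sin_add_int_mul_two_pi, Real.cos_add_int_mul_two_pi]
    rw [hPeq]
    refine ⟨-t, _, _, _, _, kepP_sol hw he0.le he1 hek (u := fun s => U (Mc + w ^ 3 * (t + s)))
      (g := fun s => gc - t - s) ?_ ?_ _, rfl, ?_, ?_⟩
    · intro s
      have h1 : HasDerivAt (fun s => Mc + w ^ 3 * (t + s)) (w ^ 3) s := by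
        simpa using (((hasDerivAt_id s).const_add t).const_mul (w ^ 3)).const_add Mc
      have := (hU3 (Mc + w ^ 3 * (t + s))).comp s h1
      rw [mul_comm] at this
      exact this
    · intro s
      exact (hasDerivAt_id s).const_sub (gc - t)
    · simp only [add_neg_cancel, mul_zero, add_zero, sub_neg_eq_add, sub_add_cancel, hMc, hU2, hx1]
    · simp only [add_neg_cancel, mul_zero, add_zero, sub_neg_eq_add, sub_add_cancel, hMc, hU2, hx2]
  have hcont : Continuous (fun z => KepP w e k (U (Mc + w ^ 3 * (gc - g) + z)) g) :=
    (kepP_cont_u he0.le he1 g).comp (hUc.comp (by fun_prop))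
  have := map_mem_closure hcont (hdense ((u - e * Real.sin u) - (Mc + w ^ 3 * (gc - g)))) key
  simpa [hU2] using this

lemma kep_dense_irr : Dense {w : ℝ | Irrational (w ^ 3)} := by
  have : ({w : ℝ | Irrational (w ^ 3)}) = ((fun w : ℝ => w ^ 3) ⁻¹' Set.range ((↑) : ℚ → ℝ))ᶜ := rfl
  rw [this]
  apply Set.Countable.dense_compl ℝ
  exact (Set.countable_range _).preimage (Odd.strictMono_pow (by decide)).injective

lemma kep_all {J : ℝ} {p : ℝ × ℝ × ℝ × ℝ} (hp : p ∈ KepVJ J) :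
    p ∈ closure {p ∈ KepVJ J | ReachesCollision p} := by
  obtain ⟨w, e, k, u, g, hc, rfl⟩ := kepP_surj hp
  obtain ⟨hw, he0, he1, hek, hk, h1, h2, hJ⟩ := hc
  let K : ℝ → ℝ := fun v => (J - v ^ 2) * v / 2
  let E : ℝ → ℝ := fun v => Real.sqrt (1 - K v ^ 2)
  have hK : K w = k := by
    simp only [K]; rw [← hJ]; field_simp; ring
  have hE : E w = e := by
    simp only [E, hK]; rw [← hek]; simp [he0.le]
  have hKc : Continuous K := by fun_prop
  have hEc : Continuous E := by fun_prop
  have hkp : 0 < k ^ 2 := by positivity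
  have hev : ∀ᶠ v in nhds w, KepCond J v (E v) (K v) := by
    have a1 : ∀ᶠ v in nhds w, 0 < v := lt_mem_nhds hw
    have a2 : ∀ᶠ v in nhds w, K v ≠ 0 := hKc.continuousAt.eventually_ne (by rwa [hK])
    have a3 : ∀ᶠ v in nhds w, K v ^ 2 < 1 :=
      (hKc.pow 2).continuousAt.eventually_lt continuousAt_const (by change K w ^ 2 < 1; rw [hK]; nlinarith)
    have a4 : ∀ᶠ v in nhds w, 1 - E v < v ^ 2 :=
      (continuous_const.sub hEc).continuousAt.eventually_lt (continuous_pow 2).continuousAt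
        (by change 1 - E w < w ^ 2; rw [hE]; exact h1)
    have a5 : ∀ᶠ v in nhds w, v ^ 2 < 1 + E v :=
      (continuous_pow 2).continuousAt.eventually_lt (continuous_const.add hEc).continuousAt
        (by change w ^ 2 < 1 + E w; rw [hE]; exact h2)
    filter_upwards [a1, a2, a3, a4, a5] with v b1 b2 b3 b4 b5
    have hkv : 0 < K v ^ 2 := by positivity
    refine ⟨b1, Real.sqrt_pos.2 (by linarith), ?_, ?_, b2, b4, b5, ?_⟩
    · rw [Real.sqrt_lt' one_pos]; linarith
    · simp only [E]; rw [Real.sq_sqrt (by linarith)]; ring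
    · simp only [K]; field_simp; ring
  have hcont : ContinuousAt (fun v => KepP v (E v) (K v) u g) w := by
    have hd : 1 - E w * Real.cos u ≠ 0 := by rw [hE]; exact (kep_den_pos he0.le he1 u).ne'
    have hw2 : w ^ 2 ≠ 0 := by positivity
    have := hKc.continuousAt (x := w)
    have := hEc.continuousAt (x := w)
    unfold KepP
    fun_prop (disch := assumption)
  have hfr : ∃ᶠ v in nhds w, Irrational (v ^ 3) := mem_closure_iff_frequently.1 (kep_dense_irr w)
  have hfr2 : ∃ᶠ v in nhds w,
      KepP v (E v) (K v) u g ∈ closure {p ∈ KepVJ J | ReachesCollision p} :=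
    (hfr.and_eventually hev).mono fun v hv => kep_irr hv.2 hv.1 u g
  have := mem_closure_iff_frequently.2 (hcont.tendsto.frequently hfr2)
  simpa [hK, hE] using this

/-- For any `J ∈ (−2√2, 3)`, the points of `𝒱_J` whose orbit under the flow of `H₀`
passes through the position `(1,0)` are dense in `𝒱_J`. -/
theorem kepler_collision_orbits_dense (J : ℝ) (hJ : J ∈ Set.Ioo (-2 * Real.sqrt 2) 3) :
    KepVJ J ⊆ closure {p ∈ KepVJ J | ReachesCollision p} := by
  exact fun p hp => kep_all hp

end
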